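/- arXiv:1908.07523 — 2 statements merged into one kernel-verified Lean document; each statement's English description precedes it below -/
import Mathlib

section
/- The conditional quantum entropy S(C|B)_ρ := S(ρ_CB) - S(ρ_B) is concave in the state: for density matrices ρ₁, ρ₂ on H_C ⊗ H_B (finite-dimensional) and λ ∈ [0,1], S(C|B)_{λρ₁+(1-λ)ρ₂} ≥ λ S(C|B)_{ρ₁} + (1-λ) S(C|B)_{ρ₂}. -/
open scoped BigOperators ComplexOrder

/-- Von Neumann entropy (in bits) of a Hermitian matrix, defined via its
eigenvalues with the convention `0 * log 0 = 0`. -/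
noncomputable def vnEntropy {n : Type*} [Fintype n] [DecidableEq n]
    (ρ : Matrix n n ℂ) (hρ : ρ.IsHermitian) : ℝ :=
  -∑ i, hρ.eigenvalues i * Real.logb 2 (hρ.eigenvalues i)

/-- Partial trace over the first (C) factor of a bipartite state on `H_C ⊗ H_B`. -/
noncomputable def ptrC {c b : Type*} [Fintype c] [Fintype b]
    (ρ : Matrix (c × b) (c × b) ℂ) : Matrix b b ℂ :=
  Matrix.of fun i j => ∑ k, ρ (k, i) (k, j)

/-- Conditional quantum entropy `S(C|B)_ρ = S(ρ_CB) - S(ρ_B)`. -/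
noncomputable def condEntropy {c b : Type*} [Fintype c] [Fintype b] [DecidableEq c] [DecidableEq b]
    (ρ : Matrix (c × b) (c × b) ℂ) (hρ : ρ.IsHermitian) (hB : (ptrC ρ).IsHermitian) : ℝ :=
  vnEntropy ρ hρ - vnEntropy (ptrC ρ) hB

open Matrix Kronecker

/-- Second-order Taylor formula for `x * log x` on a segment, at nonnegative end points. -/
theorem integral_taylor_mul_log {p q : ℝ} (hp : 0 ≤ p) (hq : 0 < q) :
    IntervalIntegrable (fun s : ℝ => (1 - s) * ((p - q) ^ 2 / ((1 - s) * q + s * p)))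
      MeasureTheory.volume 0 1 ∧
    ∫ s in (0 : ℝ)..1, (1 - s) * ((p - q) ^ 2 / ((1 - s) * q + s * p)) =
      p * Real.log p - p * Real.log q - p + q := by
  rcases hp.eq_or_lt with rfl | hp
  · have h : Set.EqOn (fun _ : ℝ => q)
        (fun s : ℝ => (1 - s) * ((0 - q) ^ 2 / ((1 - s) * q + s * 0))) (Set.uIoo 0 1) := by
      intro s hs
      rw [Set.uIoo_of_le zero_le_one] at hs
      have : 1 - s ≠ 0 := by linarith [hs.2]
      simp only
      field_simp
      simp only [mul_zero, add_zero]
      ring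
    refine ⟨(intervalIntegrable_const).congr_uIoo h, ?_⟩
    rw [← intervalIntegral.integral_congr_uIoo h]
    simp
  · have hpos : ∀ s ∈ Set.uIcc (0 : ℝ) 1, 0 < (1 - s) * q + s * p := by
      intro s hs
      rw [Set.uIcc_of_le zero_le_one] at hs
      rcases hs.1.eq_or_lt with rfl | h0
      · simpa
      · have := mul_nonneg (sub_nonneg.2 hs.2) hq.le
        positivity
    have hi : IntervalIntegrable (fun s : ℝ => (1 - s) * ((p - q) ^ 2 / ((1 - s) * q + s * p)))
        MeasureTheory.volume 0 1 := by
      apply ContinuousOn.intervalIntegrable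
      fun_prop (disch := exact fun s hs => (hpos s hs).ne')
    refine ⟨hi, ?_⟩
    rw [intervalIntegral.integral_eq_sub_of_hasDerivAt
      (f := fun s => p * Real.log ((1 - s) * q + s * p) - (p - q) * s) _ hi]
    · simp
      ring
    · intro s hs
      have hne := (hpos s hs).ne'
      have hd : HasDerivAt (fun s : ℝ => (1 - s) * q + s * p) (p - q) s := by
        refine ((((hasDerivAt_id s).const_sub 1).mul_const q).add
          ((hasDerivAt_id s).mul_const p)).congr_deriv ?_
        ring
      have hd' := ((hd.log hne).const_mul p).sub ((hasDerivAt_id s).const_mul (p - q))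
      refine hd'.congr_deriv ?_
      rw [mul_div_assoc', mul_div_assoc', eq_div_iff hne, sub_mul, div_mul_cancel₀ _ hne]
      ring

/-- The quadratic functional whose supremum over `Y` is `⟪ρ - σ, ((1-s) R_σ + s L_ρ)⁻¹ (ρ - σ)⟫`,
where `L_ρ` and `R_σ` are left and right multiplication. -/
noncomputable def quadFunctional {n : Type*} [Fintype n] (s : ℝ) (ρ σ Y : Matrix n n ℂ) : ℝ :=
  2 * (Yᴴ * (ρ - σ)).trace.re - (1 - s) * (Y * σ * Yᴴ).trace.re - s * (Yᴴ * ρ * Y).trace.re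

theorem quadFunctional_add_smul {n : Type*} [Fintype n] (s a b : ℝ)
    (ρ₁ ρ₂ σ₁ σ₂ Y : Matrix n n ℂ) :
    quadFunctional s ((a : ℂ) • ρ₁ + (b : ℂ) • ρ₂) ((a : ℂ) • σ₁ + (b : ℂ) • σ₂) Y =
      a * quadFunctional s ρ₁ σ₁ Y + b * quadFunctional s ρ₂ σ₂ Y := by
  simp only [quadFunctional, Matrix.mul_add, Matrix.add_mul, Matrix.mul_sub, Matrix.mul_smul,
    Matrix.smul_mul, trace_add, trace_sub, trace_smul, smul_eq_mul, Complex.add_re,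
    Complex.sub_re, Complex.re_ofReal_mul]
  ring

theorem quadFunctional_eq_sum {n : Type*} [Fintype n] [DecidableEq n] (s : ℝ)
    {U V : Matrix n n ℂ} (hU : Uᴴ * U = 1) (hV : Vᴴ * V = 1) (p q : n → ℝ) (y : Matrix n n ℂ) :
    quadFunctional s (U * diagonal (fun i => (p i : ℂ)) * Uᴴ)
      (V * diagonal (fun i => (q i : ℂ)) * Vᴴ) (U * y * Vᴴ) =
      ∑ i, ∑ j, (2 * ((p i - q j) * (star (y i j) * (Uᴴ * V) i j).re) -
        ((1 - s) * q j + s * p i) * Complex.normSq (y i j)) := by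
  set P : Matrix n n ℂ := diagonal (fun i => (p i : ℂ)) with hP
  set Q : Matrix n n ℂ := diagonal (fun i => (q i : ℂ)) with hQ
  have cU : ∀ M : Matrix n n ℂ, Uᴴ * (U * M) = M := fun M => by
    rw [← Matrix.mul_assoc, hU, Matrix.one_mul]
  have cV : ∀ M : Matrix n n ℂ, Vᴴ * (V * M) = M := fun M => by
    rw [← Matrix.mul_assoc, hV, Matrix.one_mul]
  have e₁ : ((U * y * Vᴴ)ᴴ * (U * P * Uᴴ - V * Q * Vᴴ)).trace =
      (yᴴ * (P * (Uᴴ * V) - (Uᴴ * V) * Q)).trace := by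
    have : (U * y * Vᴴ)ᴴ * (U * P * Uᴴ - V * Q * Vᴴ) =
        V * (yᴴ * (P * Uᴴ - Uᴴ * V * Q * Vᴴ)) := by
      simp only [conjTranspose_mul, conjTranspose_conjTranspose, Matrix.mul_sub, Matrix.mul_assoc,
        cU]
    rw [this, trace_mul_comm]
    simp only [Matrix.mul_sub, Matrix.sub_mul, Matrix.mul_assoc, hV, Matrix.mul_one]
  have e₂ : ((U * y * Vᴴ) * (V * Q * Vᴴ) * (U * y * Vᴴ)ᴴ).trace = (y * Q * yᴴ).trace := by
    have : (U * y * Vᴴ) * (V * Q * Vᴴ) * (U * y * Vᴴ)ᴴ = U * (y * Q * yᴴ * Uᴴ) := by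
      simp only [conjTranspose_mul, conjTranspose_conjTranspose, Matrix.mul_assoc, cV]
    rw [this, trace_mul_comm, Matrix.mul_assoc, hU, Matrix.mul_one]
  have e₃ : ((U * y * Vᴴ)ᴴ * (U * P * Uᴴ) * (U * y * Vᴴ)).trace = (yᴴ * P * y).trace := by
    have : (U * y * Vᴴ)ᴴ * (U * P * Uᴴ) * (U * y * Vᴴ) = V * (yᴴ * P * y * Vᴴ) := by
      simp only [conjTranspose_mul, conjTranspose_conjTranspose, Matrix.mul_assoc, cU]
    rw [this, trace_mul_comm, Matrix.mul_assoc, hV, Matrix.mul_one]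
  have f₁ : (yᴴ * (P * (Uᴴ * V) - (Uᴴ * V) * Q)).trace.re =
      ∑ i, ∑ j, (p i - q j) * (star (y i j) * (Uᴴ * V) i j).re := by
    rw [Finset.sum_comm]
    simp only [trace, diag_apply, Matrix.mul_apply (M := yᴴ), Complex.re_sum]
    refine Finset.sum_congr rfl fun j _ => Finset.sum_congr rfl fun i _ => ?_
    rw [Matrix.sub_apply, hP, hQ, diagonal_mul, mul_diagonal, conjTranspose_apply,
      ← Complex.re_ofReal_mul]
    congr 1
    push_cast
    ring
  have f₂ : (y * Q * yᴴ).trace.re = ∑ i, ∑ j, q j * Complex.normSq (y i j) := by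
    simp only [trace, diag_apply, Matrix.mul_apply (N := yᴴ), Complex.re_sum]
    refine Finset.sum_congr rfl fun i _ => Finset.sum_congr rfl fun j _ => ?_
    rw [hQ, mul_diagonal, conjTranspose_apply, mul_right_comm, Complex.star_def,
      Complex.mul_conj, ← Complex.ofReal_mul, Complex.ofReal_re, mul_comm]
  have f₃ : (yᴴ * P * y).trace.re = ∑ i, ∑ j, p i * Complex.normSq (y i j) := by
    rw [Finset.sum_comm]
    simp only [trace, diag_apply, Matrix.mul_apply (N := y), Complex.re_sum]
    refine Finset.sum_congr rfl fun i _ => Finset.sum_congr rfl fun j _ => ?_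
    rw [hP, mul_diagonal, conjTranspose_apply, mul_comm, ← mul_assoc, Complex.star_def,
      Complex.mul_conj, ← Complex.ofReal_mul, Complex.ofReal_re, mul_comm]
  rw [quadFunctional, e₁, e₂, e₃, f₁, f₂, f₃]
  simp only [Finset.mul_sum, ← Finset.sum_sub_distrib]
  refine Finset.sum_congr rfl fun i _ => Finset.sum_congr rfl fun j _ => ?_
  ring

/-- Completing the square. -/
theorem complete_square_le {d a : ℝ} (hd : 0 ≤ d) (had : d = 0 → a = 0) (w y : ℂ) :
    2 * (a * (star y * w).re) - d * Complex.normSq y ≤ Complex.normSq w * (a ^ 2 / d) := by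
  rcases hd.eq_or_lt with h0 | hd
  · simp [← h0, had h0.symm]
  · have key : Complex.normSq w * (a ^ 2 / d) -
        (2 * (a * (star y * w).re) - d * Complex.normSq y) =
        Complex.normSq ((a : ℂ) * w - d * y) / d := by
      simp only [Complex.normSq_apply, Complex.star_def, Complex.mul_re, Complex.conj_re,
        Complex.conj_im, Complex.sub_re, Complex.sub_im, Complex.mul_im, Complex.ofReal_re,
        Complex.ofReal_im]
      field_simp
      ring
    have := div_nonneg (Complex.normSq_nonneg ((a : ℂ) * w - d * y)) hd.le
    linarith

theorem complete_square_eq (d a : ℝ) (w : ℂ) :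
    2 * (a * (star (((a / d : ℝ) : ℂ) * w) * w).re) -
      d * Complex.normSq (((a / d : ℝ) : ℂ) * w) = Complex.normSq w * (a ^ 2 / d) := by
  rcases eq_or_ne d 0 with h0 | hd
  · simp [h0]
  · simp only [Complex.normSq_apply, Complex.star_def, Complex.mul_re, Complex.conj_re,
      Complex.conj_im, Complex.mul_im, Complex.ofReal_re, Complex.ofReal_im]
    field_simp
    ring

theorem sub_eq_zero_of_combo_eq_zero {s p q : ℝ} (hs : s ∈ Set.Ioo (0 : ℝ) 1)
    (hp : 0 ≤ p) (hq : 0 ≤ q) (h : (1 - s) * q + s * p = 0) : p - q = 0 := by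
  have h1 := mul_nonneg (sub_nonneg.2 hs.2.le) hq
  have h2 := mul_nonneg hs.1.le hp
  have hp0 : s * p = 0 := by linarith
  have hq0 : (1 - s) * q = 0 := by linarith
  rw [(mul_eq_zero.1 hp0).resolve_left hs.1.ne',
    (mul_eq_zero.1 hq0).resolve_left (sub_pos.2 hs.2).ne', sub_zero]

/-- The supremum over `Y` of `quadFunctional s ρ σ Y`, in terms of spectral data: eigenvalues `p`
of `ρ`, eigenvalues `q` of `σ` and squared overlaps `w` of the eigenvectors. -/
noncomputable def quadSum {n : Type*} [Fintype n] (w : n → n → ℝ) (p q : n → ℝ) (s : ℝ) : ℝ :=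
  ∑ i, ∑ j, w i j * ((p i - q j) ^ 2 / ((1 - s) * q j + s * p i))

section
variable {n : Type*} [Fintype n] [DecidableEq n] {U V : Matrix n n ℂ} {p q : n → ℝ} {s : ℝ}

theorem quadFunctional_le_quadSum (hU : Uᴴ * U = 1) (hV : Vᴴ * V = 1) (hp : ∀ i, 0 ≤ p i)
    (hq : ∀ i, 0 ≤ q i) (hs : s ∈ Set.Ioo (0 : ℝ) 1) (Y : Matrix n n ℂ) :
    quadFunctional s (U * diagonal (fun i => (p i : ℂ)) * Uᴴ)
      (V * diagonal (fun i => (q i : ℂ)) * Vᴴ) Y ≤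
      quadSum (fun i j => Complex.normSq ((Uᴴ * V) i j)) p q s := by
  have hY : Y = U * (Uᴴ * Y * V) * Vᴴ := by
    have hU' : U * Uᴴ = 1 := mul_eq_one_comm.1 hU
    have hV' : V * Vᴴ = 1 := mul_eq_one_comm.1 hV
    rw [Matrix.mul_assoc Uᴴ, ← Matrix.mul_assoc U, hU', Matrix.one_mul, Matrix.mul_assoc, hV',
      Matrix.mul_one]
  rw [hY, quadFunctional_eq_sum s hU hV]
  exact Finset.sum_le_sum fun i _ => Finset.sum_le_sum fun j _ =>
    complete_square_le (add_nonneg (mul_nonneg (sub_nonneg.2 hs.2.le) (hq j))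
      (mul_nonneg hs.1.le (hp i))) (sub_eq_zero_of_combo_eq_zero hs (hp i) (hq j)) _ _

theorem exists_quadFunctional_eq_quadSum (p q : n → ℝ) (s : ℝ) (hU : Uᴴ * U = 1)
    (hV : Vᴴ * V = 1) :
    ∃ Y, quadFunctional s (U * diagonal (fun i => (p i : ℂ)) * Uᴴ)
      (V * diagonal (fun i => (q i : ℂ)) * Vᴴ) Y =
      quadSum (fun i j => Complex.normSq ((Uᴴ * V) i j)) p q s := by
  refine ⟨U * of (fun i j => (((p i - q j) / ((1 - s) * q j + s * p i) : ℝ) : ℂ) *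
    (Uᴴ * V) i j) * Vᴴ, ?_⟩
  rw [quadFunctional_eq_sum s hU hV]
  exact Finset.sum_congr rfl fun i _ => Finset.sum_congr rfl fun j _ =>
    complete_square_eq _ _ _

end

theorem integral_quadSum {n : Type*} [Fintype n] {w : n → n → ℝ} {p q : n → ℝ}
    (hp : ∀ i, 0 ≤ p i) (hq : ∀ i, 0 ≤ q i) (hsupp : ∀ i j, q j = 0 → w i j * p i = 0) :
    IntervalIntegrable (fun s => (1 - s) * quadSum w p q s) MeasureTheory.volume 0 1 ∧
    ∫ s in (0 : ℝ)..1, (1 - s) * quadSum w p q s =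
      ∑ i, ∑ j, w i j * (p i * Real.log (p i) - p i * Real.log (q j) - p i + q j) := by
  have key : ∀ i j, IntervalIntegrable (fun s : ℝ =>
        w i j * ((1 - s) * ((p i - q j) ^ 2 / ((1 - s) * q j + s * p i))))
        MeasureTheory.volume 0 1 ∧
      ∫ s in (0 : ℝ)..1, w i j * ((1 - s) * ((p i - q j) ^ 2 / ((1 - s) * q j + s * p i))) =
        w i j * (p i * Real.log (p i) - p i * Real.log (q j) - p i + q j) := by
    intro i j
    rcases (hq j).eq_or_lt with h0 | hpos
    · rcases mul_eq_zero.1 (hsupp i j h0.symm) with h | h <;> simp [h, ← h0]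
    · obtain ⟨hi, he⟩ := integral_taylor_mul_log (hp i) hpos
      exact ⟨hi.const_mul _, by rw [intervalIntegral.integral_const_mul, he]⟩
  have hfun : (fun s => (1 - s) * quadSum w p q s) = fun s => ∑ i, ∑ j,
      w i j * ((1 - s) * ((p i - q j) ^ 2 / ((1 - s) * q j + s * p i))) := by
    funext s
    simp only [quadSum, Finset.mul_sum, mul_left_comm]
  have hint : ∀ i, IntervalIntegrable (fun s : ℝ => ∑ j,
      w i j * ((1 - s) * ((p i - q j) ^ 2 / ((1 - s) * q j + s * p i))))
      MeasureTheory.volume 0 1 := fun i => by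
    simpa [Finset.sum_fn] using IntervalIntegrable.sum Finset.univ fun j _ => (key i j).1
  rw [hfun]
  refine ⟨by simpa [Finset.sum_fn] using IntervalIntegrable.sum Finset.univ fun i _ => hint i, ?_⟩
  rw [intervalIntegral.integral_finsetSum fun i _ => hint i]
  refine Finset.sum_congr rfl fun i _ => ?_
  rw [intervalIntegral.integral_finsetSum fun j _ => (key i j).1]
  exact Finset.sum_congr rfl fun j _ => (key i j).2

theorem Matrix.IsHermitian.eq_eigenvectorUnitary_mul {n : Type*} [Fintype n] [DecidableEq n]
    {A : Matrix n n ℂ} (hA : A.IsHermitian) :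
    A = (hA.eigenvectorUnitary : Matrix n n ℂ) * diagonal (fun i => (hA.eigenvalues i : ℂ)) *
      (hA.eigenvectorUnitary : Matrix n n ℂ)ᴴ := by
  conv_lhs => rw [hA.spectral_theorem]
  rw [Unitary.conjStarAlgAut_apply, star_eq_conjTranspose]
  rfl

theorem sum_normSq_row {n : Type*} [Fintype n] [DecidableEq n] {W : Matrix n n ℂ}
    (hW : W * Wᴴ = 1) (i : n) : ∑ j, Complex.normSq (W i j) = 1 := by
  have h := congrFun (congrFun hW i) i
  simp only [Matrix.mul_apply, conjTranspose_apply, Complex.star_def, Complex.mul_conj,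
    one_apply_eq] at h
  exact_mod_cast h

theorem sum_normSq_col {n : Type*} [Fintype n] [DecidableEq n] {W : Matrix n n ℂ}
    (hW : Wᴴ * W = 1) (j : n) : ∑ i, Complex.normSq (W i j) = 1 := by
  have h := congrFun (congrFun hW j) j
  simp only [Matrix.mul_apply, conjTranspose_apply, Complex.star_def, mul_comm, Complex.mul_conj,
    one_apply_eq] at h
  exact_mod_cast h

theorem sum_normSq_mul {n : Type*} [Fintype n] [DecidableEq n] (W : Matrix n n ℂ) (p : n → ℝ)
    (j : n) : ((∑ i, Complex.normSq (W i j) * p i : ℝ) : ℂ) =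
      (Wᴴ * diagonal (fun i => (p i : ℂ)) * W) j j := by
  rw [Matrix.mul_apply]
  push_cast
  refine Finset.sum_congr rfl fun i _ => ?_
  rw [mul_diagonal, conjTranspose_apply, Complex.star_def, mul_right_comm, mul_comm _ (W i j),
    Complex.mul_conj]

section
variable {c b : Type*} [Fintype c] [Fintype b]

theorem ptrC_add_smul (x y : ℂ) (ρ₁ ρ₂ : Matrix (c × b) (c × b) ℂ) :
    ptrC (x • ρ₁ + y • ρ₂) = x • ptrC ρ₁ + y • ptrC ρ₂ := by
  ext i j
  simp [ptrC, Finset.sum_add_distrib, Finset.mul_sum]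

variable [DecidableEq c]

theorem ptrC_one_kronecker_mul (A : Matrix b b ℂ) (ρ : Matrix (c × b) (c × b) ℂ) :
    ptrC (((1 : Matrix c c ℂ) ⊗ₖ A) * ρ) = A * ptrC ρ := by
  ext i j
  simp only [ptrC, of_apply, Matrix.mul_apply, kronecker_apply, Fintype.sum_prod_type, one_apply,
    ite_mul, one_mul, zero_mul, Finset.mul_sum]
  rw [Finset.sum_comm (γ := b)]
  refine Finset.sum_congr rfl fun k _ => ?_
  rw [Finset.sum_comm]
  simp

theorem ptrC_mul_one_kronecker (A : Matrix b b ℂ) (ρ : Matrix (c × b) (c × b) ℂ) :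
    ptrC (ρ * ((1 : Matrix c c ℂ) ⊗ₖ A)) = ptrC ρ * A := by
  ext i j
  simp only [ptrC, of_apply, Matrix.mul_apply, kronecker_apply, Fintype.sum_prod_type, one_apply,
    ite_mul, one_mul, zero_mul, mul_ite, mul_zero, Finset.sum_mul]
  rw [Finset.sum_comm (γ := b)]
  refine Finset.sum_congr rfl fun k _ => ?_
  rw [Finset.sum_comm]
  simp

variable [DecidableEq b]

theorem log_two_mul_vnEntropy {n : Type*} [Fintype n] [DecidableEq n] {ρ : Matrix n n ℂ}
    (hρ : ρ.IsHermitian) :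
    Real.log 2 * vnEntropy ρ hρ = -∑ i, hρ.eigenvalues i * Real.log (hρ.eigenvalues i) := by
  rw [vnEntropy, mul_neg, Finset.mul_sum]
  congr 1
  refine Finset.sum_congr rfl fun i _ => ?_
  rw [mul_left_comm, Real.logb, mul_div_cancel₀ _ (Real.log_pos one_lt_two).ne.symm]

/-- Integral formula for the negative conditional entropy, viewed as the relative entropy of `ρ`
with respect to `1 ⊗ ρ_B`; the integrand is a supremum of functionals affine in `ρ`. -/
theorem exists_condEntropy_eq_integral {ρ : Matrix (c × b) (c × b) ℂ} (hρ : ρ.PosSemidef)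
    (hB : (ptrC ρ).IsHermitian) :
    ∃ F : ℝ → ℝ, IntervalIntegrable (fun s => (1 - s) * F s) MeasureTheory.volume 0 1 ∧
      ∫ s in (0 : ℝ)..1, (1 - s) * F s =
        -(Real.log 2 * condEntropy ρ hρ.1 hB) + (Fintype.card c - 1) * ρ.trace.re ∧
      ∀ s ∈ Set.Ioo (0 : ℝ) 1,
        (∀ Y, quadFunctional s ρ ((1 : Matrix c c ℂ) ⊗ₖ ptrC ρ) Y ≤ F s) ∧
        ∃ Y, quadFunctional s ρ ((1 : Matrix c c ℂ) ⊗ₖ ptrC ρ) Y = F s := by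
  set U : Matrix (c × b) (c × b) ℂ := hρ.1.eigenvectorUnitary.1 with hUdef
  set VB : Matrix b b ℂ := hB.eigenvectorUnitary.1 with hVBdef
  set p := hρ.1.eigenvalues with hpdef
  set r := hB.eigenvalues with hrdef
  set V : Matrix (c × b) (c × b) ℂ := (1 : Matrix c c ℂ) ⊗ₖ VB with hVdef
  set q : c × b → ℝ := fun x => r x.2 with hqdef
  have hU : Uᴴ * U = 1 := hρ.1.eigenvectorUnitary.2.1
  have hVB : VBᴴ * VB = 1 := hB.eigenvectorUnitary.2.1
  have hVH : Vᴴ = (1 : Matrix c c ℂ) ⊗ₖ VBᴴ := by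
    rw [hVdef, conjTranspose_kronecker, conjTranspose_one]
  have hV : Vᴴ * V = 1 := by
    rw [hVH, hVdef, ← mul_kronecker_mul, hVB, Matrix.one_mul, one_kronecker_one]
  have hρU : ρ = U * diagonal (fun i => (p i : ℂ)) * Uᴴ := hρ.1.eq_eigenvectorUnitary_mul
  have hBV : ptrC ρ = VB * diagonal (fun i => (r i : ℂ)) * VBᴴ := hB.eq_eigenvectorUnitary_mul
  have hσ : (1 : Matrix c c ℂ) ⊗ₖ ptrC ρ = V * diagonal (fun i => (q i : ℂ)) * Vᴴ := by
    have hd : diagonal (fun i => (q i : ℂ)) =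
        (1 : Matrix c c ℂ) ⊗ₖ diagonal (fun i => (r i : ℂ)) := by
      rw [← diagonal_one, diagonal_kronecker_diagonal]
      simp [hqdef]
    rw [hd, hVH, hVdef, ← mul_kronecker_mul, ← mul_kronecker_mul, ← hBV, Matrix.one_mul,
      Matrix.one_mul]
  set w : c × b → c × b → ℝ := fun i j => Complex.normSq ((Uᴴ * V) i j) with hwdef
  have hw : ∀ i j, 0 ≤ w i j := fun i j => Complex.normSq_nonneg _
  have hp : ∀ i, 0 ≤ p i := hρ.eigenvalues_nonneg
  have hWW : (Uᴴ * V)ᴴ * (Uᴴ * V) = 1 := by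
    rw [conjTranspose_mul, conjTranspose_conjTranspose, Matrix.mul_assoc, ← Matrix.mul_assoc U,
      mul_eq_one_comm.1 hU, Matrix.one_mul, hV]
  have hrow : ∀ i, ∑ j, w i j = 1 := sum_normSq_row (mul_eq_one_comm.1 hWW)
  have hcol : ∀ j, ∑ i, w i j = 1 := sum_normSq_col hWW
  have hmarg : ∀ j, ∑ k, ∑ i, w i (k, j) * p i = r j := by
    intro j
    apply Complex.ofReal_injective
    have e : (Uᴴ * V)ᴴ * diagonal (fun i => (p i : ℂ)) * (Uᴴ * V) = Vᴴ * ρ * V := by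
      rw [hρU]
      simp only [conjTranspose_mul, conjTranspose_conjTranspose, Matrix.mul_assoc]
    have e' : ptrC (Vᴴ * ρ * V) = diagonal (fun i => (r i : ℂ)) := by
      rw [hVdef, ptrC_mul_one_kronecker, ← hVdef, hVH, ptrC_one_kronecker_mul, hBV]
      simp only [Matrix.mul_assoc, hVB, Matrix.mul_one]
      rw [← Matrix.mul_assoc, hVB, Matrix.one_mul]
    have e'' := congrFun (congrFun e' j) j
    rw [diagonal_apply_eq] at e''
    rw [← e'', Complex.ofReal_sum]
    simp only [hwdef, sum_normSq_mul, e, ptrC, of_apply]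
  have hr : ∀ j, 0 ≤ r j := fun j => hmarg j ▸
    Finset.sum_nonneg fun k _ => Finset.sum_nonneg fun i _ => mul_nonneg (hw _ _) (hp i)
  have hq : ∀ x, 0 ≤ q x := fun x => hr x.2
  have hsupp : ∀ i j, q j = 0 → w i j * p i = 0 := by
    rintro i ⟨k, j⟩ h
    have hnn : ∀ k' i', 0 ≤ w i' (k', j) * p i' := fun _ i' => mul_nonneg (hw _ _) (hp i')
    have h0 : ∑ k, ∑ i, w i (k, j) * p i = 0 := (hmarg j).trans h
    rw [Finset.sum_eq_zero_iff_of_nonneg fun k' _ => Finset.sum_nonneg fun i' _ => hnn k' i'] at h0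
    have h1 := h0 k (Finset.mem_univ k)
    rw [Finset.sum_eq_zero_iff_of_nonneg fun i' _ => hnn k i'] at h1
    exact h1 i (Finset.mem_univ i)
  obtain ⟨hint, hval⟩ := integral_quadSum hp hq hsupp
  refine ⟨quadSum w p q, hint, ?_, fun s hs => ?_⟩
  · have htr : ρ.trace.re = ∑ i, p i := by
      rw [hρ.1.trace_eq_sum_eigenvalues]
      simp [hpdef]
    have s₁ : ∑ i, ∑ j, w i j * (p i * Real.log (p i)) = ∑ i, p i * Real.log (p i) := by
      simp only [← Finset.sum_mul, hrow, one_mul]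
    have s₂ : ∑ i, ∑ j, w i j * (p i * Real.log (q j)) = ∑ j, r j * Real.log (r j) := by
      rw [Finset.sum_comm, Fintype.sum_prod_type, Finset.sum_comm]
      refine Finset.sum_congr rfl fun j _ => ?_
      simp only [hqdef, ← mul_assoc, ← Finset.sum_mul]
      rw [hmarg]
    have s₃ : ∑ i, ∑ j, w i j * p i = ∑ i, p i := by
      simp only [← Finset.sum_mul, hrow, one_mul]
    have s₄ : ∑ i, ∑ j, w i j * q j = Fintype.card c * ∑ i, p i := by
      have hrp : ∑ j, r j = ∑ i, p i := by
        rw [← s₃, Finset.sum_comm, Fintype.sum_prod_type, Finset.sum_comm]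
        exact Finset.sum_congr rfl fun j _ => (hmarg j).symm
      rw [Finset.sum_comm]
      simp only [← Finset.sum_mul, hcol, one_mul]
      simp [Fintype.sum_prod_type, hqdef, hrp]
    rw [hval, condEntropy, mul_sub, log_two_mul_vnEntropy, log_two_mul_vnEntropy, htr]
    simp only [mul_add, mul_sub, Finset.sum_add_distrib, Finset.sum_sub_distrib, s₁, s₂, s₃, s₄]
    ring
  · rw [hσ]
    constructor
    · intro Y
      conv_lhs => rw [hρU]
      exact quadFunctional_le_quadSum hU hV hp hq hs Y
    · obtain ⟨Y, hY⟩ := exists_quadFunctional_eq_quadSum p q s hU hV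
      refine ⟨Y, ?_⟩
      conv_lhs => rw [hρU]
      exact hY

end

/-- Concavity of the conditional quantum entropy in the state. -/
theorem condEntropy_concave {c b : Type*} [Fintype c] [Fintype b] [DecidableEq c] [DecidableEq b]
    (ρ₁ ρ₂ : Matrix (c × b) (c × b) ℂ)
    (h₁ : ρ₁.PosSemidef) (ht₁ : ρ₁.trace = 1)
    (h₂ : ρ₂.PosSemidef) (ht₂ : ρ₂.trace = 1)
    (lam : ℝ) (hlam0 : 0 ≤ lam) (hlam1 : lam ≤ 1)
    (hmix : ((lam : ℂ) • ρ₁ + ((1 - lam : ℝ) : ℂ) • ρ₂).IsHermitian)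
    (hmixB : (ptrC ((lam : ℂ) • ρ₁ + ((1 - lam : ℝ) : ℂ) • ρ₂)).IsHermitian)
    (h₁B : (ptrC ρ₁).IsHermitian) (h₂B : (ptrC ρ₂).IsHermitian) :
    condEntropy ((lam : ℂ) • ρ₁ + ((1 - lam : ℝ) : ℂ) • ρ₂) hmix hmixB ≥
      lam * condEntropy ρ₁ h₁.1 h₁B + (1 - lam) * condEntropy ρ₂ h₂.1 h₂B := by
  have hlam1' : 0 ≤ 1 - lam := sub_nonneg.2 hlam1
  have hpsd : ((lam : ℂ) • ρ₁ + ((1 - lam : ℝ) : ℂ) • ρ₂).PosSemidef :=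
    (h₁.smul (Complex.zero_le_real.2 hlam0)).add (h₂.smul (Complex.zero_le_real.2 hlam1'))
  obtain ⟨F, hF, hFint, hFs⟩ := exists_condEntropy_eq_integral hpsd hmixB
  obtain ⟨F₁, hF₁, hFint₁, hFs₁⟩ := exists_condEntropy_eq_integral h₁ h₁B
  obtain ⟨F₂, hF₂, hFint₂, hFs₂⟩ := exists_condEntropy_eq_integral h₂ h₂B
  have hle := intervalIntegral.integral_mono_on_of_le_Ioo zero_le_one hF
    ((hF₁.const_mul lam).add (hF₂.const_mul (1 - lam))) (fun s hs => by
      obtain ⟨Y, hY⟩ := (hFs s hs).2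
      have hσ : (1 : Matrix c c ℂ) ⊗ₖ ptrC ((lam : ℂ) • ρ₁ + ((1 - lam : ℝ) : ℂ) • ρ₂) =
          (lam : ℂ) • ((1 : Matrix c c ℂ) ⊗ₖ ptrC ρ₁) +
            ((1 - lam : ℝ) : ℂ) • ((1 : Matrix c c ℂ) ⊗ₖ ptrC ρ₂) := by
        rw [ptrC_add_smul, kronecker_add, kronecker_smul, kronecker_smul]
      rw [hσ, quadFunctional_add_smul] at hY
      have i₁ := mul_le_mul_of_nonneg_left ((hFs₁ s hs).1 Y) hlam0
      have i₂ := mul_le_mul_of_nonneg_left ((hFs₂ s hs).1 Y) hlam1'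
      have i₃ := mul_le_mul_of_nonneg_left (hY ▸ add_le_add i₁ i₂) (sub_nonneg.2 hs.2.le)
      refine i₃.trans_eq ?_
      ring)
  rw [intervalIntegral.integral_add (hF₁.const_mul lam) (hF₂.const_mul (1 - lam)),
    intervalIntegral.integral_const_mul, intervalIntegral.integral_const_mul, hFint, hFint₁,
    hFint₂] at hle
  simp only [trace_add, trace_smul, ht₁, ht₂, smul_eq_mul, mul_one, Complex.add_re,
    Complex.ofReal_re, Complex.one_re] at hle
  have hlog : 0 < Real.log 2 := Real.log_pos one_lt_two
  refine le_of_mul_le_mul_left ?_ hlog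
  linarith
end

section
/- If ρ_CB is a separable state on H_C ⊗ H_B, i.e. ρ_CB = Σᵢ pᵢ |cᵢ⟩⟨cᵢ| ⊗ |bᵢ⟩⟨bᵢ| with pᵢ ≥ 0 summing to 1, then the conditional entropy satisfies S(C|B)_{ρ_CB} ≥ 0; equivalently the coherent information I_c = -S(C|B) ≤ 0. -/
open scoped BigOperators ComplexOrder Kronecker

/-- Rank-one projection `|w⟩⟨w|` onto a vector `w`. -/
noncomputable def proj {n : Type*} [Fintype n] (w : n → ℂ) : Matrix n n ℂ :=
  Matrix.vecMulVec w (star w)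

open Matrix in
/-- Expansion of the quadratic form of a Hermitian matrix in its eigenbasis. -/
theorem quadForm_eq_sum_eigenvalues {n : Type*} [Fintype n] [DecidableEq n]
    {M : Matrix n n ℂ} (hM : M.IsHermitian) (v : n → ℂ) :
    (star v ⬝ᵥ M *ᵥ v).re =
      ∑ j, hM.eigenvalues j * ‖star ⇑(hM.eigenvectorBasis j) ⬝ᵥ v‖ ^ 2 := by
  have key : ∀ j, star ⇑(hM.eigenvectorBasis j) ⬝ᵥ M *ᵥ v =
      hM.eigenvalues j * (star ⇑(hM.eigenvectorBasis j) ⬝ᵥ v) := fun j => by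
    have h : star ⇑(hM.eigenvectorBasis j) ᵥ* M =
        star (M *ᵥ ⇑(hM.eigenvectorBasis j)) := by
      rw [star_mulVec, hM.eq]
    rw [dotProduct_mulVec, h, hM.mulVec_eigenvectorBasis]
    simp [star_smul, smul_dotProduct]
  have h := hM.eigenvectorBasis.sum_inner_mul_inner (WithLp.toLp 2 v) (WithLp.toLp 2 (M *ᵥ v))
  simp only [EuclideanSpace.inner_eq_star_dotProduct] at h
  rw [dotProduct_comm, ← h, Complex.re_sum]
  refine Finset.sum_congr rfl fun j _ => ?_
  rw [dotProduct_comm (M *ᵥ v), key]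
  have h2 : (hM.eigenvectorBasis j).ofLp ⬝ᵥ star v =
      star (star ⇑(hM.eigenvectorBasis j) ⬝ᵥ v) := by
    rw [star_dotProduct, star_star, dotProduct_comm]
  rw [h2, mul_left_comm, Complex.star_def, Complex.conj_mul', Complex.re_ofReal_mul]
  norm_cast

open Matrix in
/-- Parseval's identity for an orthonormal basis of `ℂⁿ`, in coordinates. -/
theorem sum_norm_sq_star_dotProduct {n : Type*} [Fintype n]
    (e : OrthonormalBasis n ℂ (EuclideanSpace ℂ n)) (v : n → ℂ) :
    ∑ k, ‖star ⇑(e k) ⬝ᵥ v‖ ^ 2 = ∑ z, ‖v z‖ ^ 2 := by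
  have h := e.sum_sq_norm_inner_right (WithLp.toLp 2 v)
  rw [EuclideanSpace.norm_sq_eq] at h
  simpa [EuclideanSpace.inner_eq_star_dotProduct, dotProduct_comm] using h

open Matrix in
theorem quadForm_proj {n : Type*} [Fintype n] (w v : n → ℂ) :
    (star v ⬝ᵥ proj w *ᵥ v) = ((‖star w ⬝ᵥ v‖ ^ 2 : ℝ) : ℂ) := by
  have : star v ⬝ᵥ w = star (star w ⬝ᵥ v) := by
    rw [star_dotProduct]
  simp [proj, vecMulVec_mulVec, this, Complex.mul_conj']

/-- A coupling `lam j * A j k` of two spectra,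
with `lam j * ∑ k, A j k / mu k ≤ 1`, compares
their entropies. -/
theorem sum_mul_log_le_of_coupling {m n : Type*} [Fintype m] [Fintype n]
    (lam : m → ℝ) (mu : n → ℝ) (A : m → n → ℝ) (hlam : ∀ j, 0 ≤ lam j)
    (hA : ∀ j k, 0 ≤ A j k) (hrow : ∀ j, ∑ k, A j k = 1)
    (hcol : ∀ k, ∑ j, lam j * A j k = mu k) (hinv : ∀ j, lam j * ∑ k, A j k * (mu k)⁻¹ ≤ 1) :
    ∑ j, lam j * Real.log (lam j) ≤ ∑ k, mu k * Real.log (mu k) := by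
  have hle : ∀ j k, lam j * A j k ≤ mu k := fun j k => by
    rw [← hcol k]
    exact Finset.single_le_sum (f := fun j => lam j * A j k)
      (fun i _ => mul_nonneg (hlam i) (hA i k)) (Finset.mem_univ j)
  have hterm : ∀ j k, lam j * A j k * (Real.log (lam j) - Real.log (mu k)) ≤
      lam j * A j k * (lam j * (mu k)⁻¹ - 1) := fun j k => by
    rcases (mul_nonneg (hlam j) (hA j k)).eq_or_lt with h0 | h0
    · simp [← h0]
    · have hl : 0 < lam j := (hlam j).lt_of_ne fun h => by simp [← h] at h0
      have hm : 0 < mu k := h0.trans_le (hle j k)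
      refine mul_le_mul_of_nonneg_left ?_ h0.le
      rw [← Real.log_div hl.ne' hm.ne', ← div_eq_mul_inv]
      exact Real.log_le_sub_one_of_pos (div_pos hl hm)
  have h1 : ∑ j, lam j * Real.log (lam j) = ∑ j, ∑ k, lam j * A j k * Real.log (lam j) := by
    refine Finset.sum_congr rfl fun j _ => ?_
    rw [← Finset.sum_mul, ← Finset.mul_sum, hrow, mul_one]
  have h2 : ∑ k, mu k * Real.log (mu k) = ∑ j, ∑ k, lam j * A j k * Real.log (mu k) := by
    rw [Finset.sum_comm]
    refine Finset.sum_congr rfl fun k _ => ?_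
    rw [← Finset.sum_mul, hcol]
  rw [← sub_nonpos, h1, h2, ← Finset.sum_sub_distrib]
  refine Finset.sum_nonpos fun j _ => ?_
  calc ∑ k, lam j * A j k * Real.log (lam j) - ∑ k, lam j * A j k * Real.log (mu k)
      = ∑ k, lam j * A j k * (Real.log (lam j) - Real.log (mu k)) := by
        rw [← Finset.sum_sub_distrib]; simp only [mul_sub]
    _ ≤ ∑ k, lam j * A j k * (lam j * (mu k)⁻¹ - 1) := Finset.sum_le_sum fun k _ => hterm j k
    _ = lam j * (lam j * ∑ k, A j k * (mu k)⁻¹ - ∑ k, A j k) := by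
        rw [Finset.mul_sum, ← Finset.sum_sub_distrib, Finset.mul_sum]
        exact Finset.sum_congr rfl fun k _ => by ring
    _ ≤ 0 := by
        rw [hrow]
        exact mul_nonpos_of_nonneg_of_nonpos (hlam j) (sub_nonpos.mpr (hinv j))

open Matrix in
/-- The quadratic form of `ρ` summed over `|x⟩ ⊗ v` is that of the partial trace. -/
theorem quadForm_ptrC {c b : Type*} [Fintype c] [Fintype b] [DecidableEq c]
    (ρ : Matrix (c × b) (c × b) ℂ) (v : b → ℂ) :
    star v ⬝ᵥ ptrC ρ *ᵥ v =
      ∑ x, star (fun q : c × b => if q.1 = x then v q.2 else 0) ⬝ᵥ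
        ρ *ᵥ (fun q : c × b => if q.1 = x then v q.2 else 0) := by
  simp only [dotProduct, mulVec, ptrC, of_apply, Fintype.sum_prod_type, Pi.star_apply,
    apply_ite star, star_zero, ite_mul, mul_ite, zero_mul, mul_zero, Finset.sum_ite_irrel,
    Finset.sum_const_zero, Finset.sum_ite_eq', Finset.mem_univ, if_true, Finset.sum_mul]
  rw [Finset.sum_comm]
  refine Finset.sum_congr rfl fun z _ => ?_
  rw [← Finset.mul_sum, Finset.sum_comm]

open Matrix in
theorem ptrC_kronecker_proj {c b ι : Type*} [Fintype c] [Fintype b] [Fintype ι]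
    (p : ι → ℝ) (cv : ι → c → ℂ) (bv : ι → b → ℂ) (hcv : ∀ i, ∑ x, ‖cv i x‖ ^ 2 = 1) :
    ptrC (∑ i, ((p i : ℝ) : ℂ) • (proj (cv i) ⊗ₖ proj (bv i))) =
      ∑ i, ((p i : ℝ) : ℂ) • proj (bv i) := by
  ext z w
  simp only [ptrC, of_apply, Matrix.sum_apply, Matrix.smul_apply, kroneckerMap_apply, smul_eq_mul]
  rw [Finset.sum_comm]
  refine Finset.sum_congr rfl fun i _ => ?_
  rw [← Finset.mul_sum, ← Finset.sum_mul]
  have : ∑ x, proj (cv i) x x = 1 := by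
    simp only [proj, vecMulVec_apply, Pi.star_apply, Complex.star_def, Complex.mul_conj']
    exact_mod_cast hcv i
  rw [this, one_mul]

open Matrix in
theorem quadForm_sum_smul_proj {n ι : Type*} [Fintype n] [Fintype ι]
    (p : ι → ℝ) (w : ι → n → ℂ) (v : n → ℂ) :
    (star v ⬝ᵥ (∑ i, ((p i : ℝ) : ℂ) • proj (w i)) *ᵥ v).re =
      ∑ i, p i * ‖star (w i) ⬝ᵥ v‖ ^ 2 := by
  rw [sum_mulVec, dotProduct_sum, Complex.re_sum]
  refine Finset.sum_congr rfl fun i _ => ?_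
  rw [smul_mulVec, dotProduct_smul, quadForm_proj, smul_eq_mul, ← Complex.ofReal_mul,
    Complex.ofReal_re]

theorem proj_kronecker_proj {c b : Type*} [Fintype c] [Fintype b] (u : c → ℂ) (v : b → ℂ) :
    proj u ⊗ₖ proj v = proj fun q : c × b => u q.1 * v q.2 := by
  ext ⟨x, z⟩ ⟨x', z'⟩
  simp [proj, Matrix.vecMulVec_apply, mul_mul_mul_comm]

open Matrix in
/-- Contracting with a product vector `u ⊗ v`, where `u` is a unit vector, is bounded by
contracting with `v` alone. -/
theorem norm_sq_star_prod_dotProduct_le {c b : Type*} [Fintype c] [Fintype b]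
    (u : c → ℂ) (hu : ∑ x, ‖u x‖ ^ 2 = 1) (v : b → ℂ) (y : c × b → ℂ) :
    ‖star (fun q : c × b => u q.1 * v q.2) ⬝ᵥ y‖ ^ 2 ≤
      ∑ x, ‖star v ⬝ᵥ fun z => y (x, z)‖ ^ 2 := by
  have h : star (fun q : c × b => u q.1 * v q.2) ⬝ᵥ y =
      ∑ x, star (u x) * (star v ⬝ᵥ fun z => y (x, z)) := by
    simp [dotProduct, Fintype.sum_prod_type, Finset.mul_sum, mul_assoc]
  calc ‖star (fun q : c × b => u q.1 * v q.2) ⬝ᵥ y‖ ^ 2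
      ≤ (∑ x, ‖u x‖ * ‖star v ⬝ᵥ fun z => y (x, z)‖) ^ 2 := by
        rw [h]
        gcongr
        refine (norm_sum_le _ _).trans_eq ?_
        simp
    _ ≤ (∑ x, ‖u x‖ ^ 2) * ∑ x, ‖star v ⬝ᵥ fun z => y (x, z)‖ ^ 2 :=
        Finset.sum_mul_sq_le_sq_mul_sq _ _ _
    _ = _ := by rw [hu, one_mul]

open Matrix in
/-- The reduction criterion `ρ ≤ 1 ⊗ ρ_B` for separable states, as an inequality of
quadratic forms. -/
theorem quadForm_separable_le {c b ι : Type*} [Fintype c] [Fintype b] [Fintype ι]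
    (p : ι → ℝ) (hp : ∀ i, 0 ≤ p i) (cv : ι → c → ℂ) (bv : ι → b → ℂ)
    (hcv : ∀ i, ∑ x, ‖cv i x‖ ^ 2 = 1) (ρ : Matrix (c × b) (c × b) ℂ)
    (hρdef : ρ = ∑ i, ((p i : ℝ) : ℂ) • (proj (cv i) ⊗ₖ proj (bv i))) (y : c × b → ℂ) :
    (star y ⬝ᵥ ρ *ᵥ y).re ≤
      ∑ x, (star (fun z => y (x, z)) ⬝ᵥ ptrC ρ *ᵥ fun z => y (x, z)).re := by
  subst hρdef
  rw [ptrC_kronecker_proj p cv bv hcv]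
  simp only [proj_kronecker_proj, quadForm_sum_smul_proj]
  rw [Finset.sum_comm]
  refine Finset.sum_le_sum fun i _ => ?_
  rw [← Finset.mul_sum]
  exact mul_le_mul_of_nonneg_left
    (norm_sq_star_prod_dotProduct_le (cv i) (hcv i) (bv i) y) (hp i)

open Matrix in
/-- A state `ρ` with `0 ≤ ρ ≤ 1 ⊗ ρ_B` has nonnegative conditional entropy. -/
theorem condEntropy_nonneg_of_quadForm_le {c b : Type*} [Fintype c] [Fintype b]
    [DecidableEq c] [DecidableEq b] (ρ : Matrix (c × b) (c × b) ℂ)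
    (hρ : ρ.IsHermitian) (hρB : (ptrC ρ).IsHermitian) (hpos : ∀ j, 0 ≤ hρ.eigenvalues j)
    (hred : ∀ y : c × b → ℂ, (star y ⬝ᵥ ρ *ᵥ y).re ≤
      ∑ x, (star (fun z => y (x, z)) ⬝ᵥ ptrC ρ *ᵥ fun z => y (x, z)).re) :
    0 ≤ condEntropy ρ hρ hρB := by
  set e := hρ.eigenvectorBasis with he
  set f := hρB.eigenvectorBasis with hf
  let a : c × b → b → c → ℂ := fun j k x => star ⇑(f k) ⬝ᵥ fun z => e j (x, z)
  let A : c × b → b → ℝ := fun j k => ∑ x, ‖a j k x‖ ^ 2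
  have hf_orth : ∀ k l, star ⇑(f k) ⬝ᵥ ⇑(f l) = if k = l then 1 else 0 := fun k l => by
    rw [← orthonormal_iff_ite.mp f.orthonormal k l, EuclideanSpace.inner_eq_star_dotProduct,
      dotProduct_comm]
  have hrow : ∀ j, ∑ k, A j k = 1 := fun j => by
    simp only [A, a]
    rw [Finset.sum_comm]
    simp only [sum_norm_sq_star_dotProduct]
    rw [← Fintype.sum_prod_type' (f := fun x z => ‖e j (x, z)‖ ^ 2)]
    have h := EuclideanSpace.norm_sq_eq (e j)
    rw [e.norm_eq_one] at h
    simpa using h.symm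
  have hcol : ∀ k, ∑ j, hρ.eigenvalues j * A j k = hρB.eigenvalues k := fun k => by
    have h := congrArg Complex.re (quadForm_ptrC ρ (f k))
    rw [quadForm_eq_sum_eigenvalues hρB, Complex.re_sum] at h
    simp only [quadForm_eq_sum_eigenvalues hρ, ← he, ← hf, hf_orth] at h
    rw [Finset.sum_comm] at h
    have h1 : ∀ j x, ‖star ⇑(e j) ⬝ᵥ fun q : c × b => if q.1 = x then f k q.2 else 0‖ =
        ‖a j k x‖ := fun j x => by
      rw [← norm_star, ← star_dotProduct]
      simp [a, dotProduct, Fintype.sum_prod_type, apply_ite, ite_mul, Finset.sum_ite_irrel]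
    simp only [h1, ← Finset.mul_sum] at h
    refine h.symm.trans ?_
    simp [apply_ite norm]
  have hinv : ∀ j, hρ.eigenvalues j * ∑ k, A j k * (hρB.eigenvalues k)⁻¹ ≤ 1 := fun j => by
    set t := ∑ k, A j k * (hρB.eigenvalues k)⁻¹ with ht
    -- `y = (1 ⊗ ρ_B⁺) e_j`
    let y : c × b → ℂ := fun q =>
      ∑ k, (((hρB.eigenvalues k)⁻¹ : ℝ) : ℂ) * a j k q.1 * f k q.2
    have hyf : ∀ x k, (star ⇑(f k) ⬝ᵥ fun z => y (x, z)) =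
        (((hρB.eigenvalues k)⁻¹ : ℝ) : ℂ) * a j k x := fun x k => by
      have : (fun z => y (x, z)) =
          ∑ l, ((((hρB.eigenvalues l)⁻¹ : ℝ) : ℂ) * a j l x) • ⇑(f l) := by
        ext z
        simp [y]
      rw [this, dotProduct_sum]
      simp [hf_orth]
    have hye : star ⇑(e j) ⬝ᵥ y = (t : ℂ) := by
      have h1 : ∀ x k, ∑ z, star (e j (x, z)) * f k z = star (a j k x) := fun x k => by
        simp [a, dotProduct, mul_comm]
      calc star ⇑(e j) ⬝ᵥ y
          = ∑ x, ∑ k, (((hρB.eigenvalues k)⁻¹ : ℝ) : ℂ) * a j k x *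
              ∑ z, star (e j (x, z)) * f k z := by
            simp only [dotProduct, Fintype.sum_prod_type, y, Finset.mul_sum, Pi.star_apply]
            refine Finset.sum_congr rfl fun x _ => ?_
            rw [Finset.sum_comm]
            exact Finset.sum_congr rfl fun k _ => Finset.sum_congr rfl fun z _ => by ring
        _ = (t : ℂ) := by
            rw [Finset.sum_comm, ht]
            push_cast [A]
            refine Finset.sum_congr rfl fun k _ => ?_
            rw [Finset.sum_mul]
            refine Finset.sum_congr rfl fun x _ => ?_
            rw [h1, mul_assoc, Complex.star_def, Complex.mul_conj', mul_comm]
    have hupper : ∑ x, (star (fun z => y (x, z)) ⬝ᵥ ptrC ρ *ᵥ fun z => y (x, z)).re = t := by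
      simp only [quadForm_eq_sum_eigenvalues hρB, ← hf, hyf]
      rw [Finset.sum_comm, ht]
      refine Finset.sum_congr rfl fun k _ => ?_
      simp only [A, Finset.sum_mul]
      refine Finset.sum_congr rfl fun x _ => ?_
      rw [norm_mul, Complex.norm_real, mul_pow, Real.norm_eq_abs, sq_abs]
      rcases eq_or_ne (hρB.eigenvalues k) 0 with h0 | h0
      · simp [h0]
      · field_simp
    have hlower : hρ.eigenvalues j * t ^ 2 ≤ (star y ⬝ᵥ ρ *ᵥ y).re := by
      rw [quadForm_eq_sum_eigenvalues hρ]
      refine le_trans (le_of_eq ?_) (Finset.single_le_sum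
        (f := fun i => hρ.eigenvalues i * ‖star ⇑(hρ.eigenvectorBasis i) ⬝ᵥ y‖ ^ 2)
        (fun i _ => mul_nonneg (hpos i) (sq_nonneg _)) (Finset.mem_univ j))
      simp only [← he, hye, Complex.norm_real, Real.norm_eq_abs, sq_abs]
    have hle : hρ.eigenvalues j * t ^ 2 ≤ t := hlower.trans ((hred y).trans_eq hupper)
    by_contra! hlt
    have htpos : 0 < t := pos_of_mul_pos_right (zero_lt_one.trans hlt) (hpos j)
    nlinarith
  have hlog := sum_mul_log_le_of_coupling _ _ A hpos
    (fun j k => Finset.sum_nonneg fun x _ => sq_nonneg _) hrow hcol hinv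
  simp only [condEntropy, vnEntropy, Real.logb, ← mul_div_assoc, ← Finset.sum_div]
  rw [sub_neg_eq_add, neg_add_eq_sub, ← sub_div]
  exact div_nonneg (sub_nonneg.mpr hlog) (Real.log_nonneg one_le_two)

/-- A separable state `ρ_CB = Σᵢ pᵢ |cᵢ⟩⟨cᵢ| ⊗ |bᵢ⟩⟨bᵢ|` has nonnegative
conditional entropy `S(C|B) ≥ 0`; equivalently the coherent information
`I_c = -S(C|B)` is nonpositive. -/
theorem condEntropy_nonneg_of_separable {c b ι : Type*} [Fintype c] [Fintype b] [Fintype ι]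
    [DecidableEq c] [DecidableEq b]
    (p : ι → ℝ) (hp : ∀ i, 0 ≤ p i) (hpsum : ∑ i, p i = 1)
    (cv : ι → c → ℂ) (bv : ι → b → ℂ)
    (hcv : ∀ i, ∑ x, ‖cv i x‖ ^ 2 = 1) (hbv : ∀ i, ∑ x, ‖bv i x‖ ^ 2 = 1)
    (ρ : Matrix (c × b) (c × b) ℂ)
    (hρdef : ρ = ∑ i, ((p i : ℝ) : ℂ) • (proj (cv i) ⊗ₖ proj (bv i)))
    (hρ : ρ.IsHermitian) (hρB : (ptrC ρ).IsHermitian) :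
    0 ≤ condEntropy ρ hρ hρB := by
  refine condEntropy_nonneg_of_quadForm_le ρ hρ hρB (fun j => ?_)
    (quadForm_separable_le p hp cv bv hcv ρ hρdef)
  have hpsd : ρ.PosSemidef := by
    rw [hρdef]
    refine Matrix.posSemidef_sum _ fun i _ => ?_
    rw [proj_kronecker_proj]
    exact (Matrix.posSemidef_vecMulVec_self_star _).smul (by exact_mod_cast hp i)
  exact hpsd.eigenvalues_nonneg j
end
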